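/- With A_z, P_z as in Miczek's 2×2 setting (0 < M u < a, p ∈ ℝ), the matrix |P_z A_z| P_zᵀ is positive definite: its symmetric part has trace 2a² det(P_z)/(M² a_p) > 0 and determinant a²(a² − M² u²) det(P_z)²/(M⁴ a_p²) > 0. -/

import Mathlib

open Matrix

/-- A real binary quadratic form with positive trace and positive determinant `α γ - β²` is
positive definite. -/
theorem binary_form_pos {α β γ : ℝ} (htr : 0 < α + γ) (hdet : 0 < α * γ - β ^ 2)
    {x y : ℝ} (hxy : x ≠ 0 ∨ y ≠ 0) :
    0 < α * x ^ 2 + 2 * β * (x * y) + γ * y ^ 2 := by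
  have hprod : 0 < α * γ := by nlinarith [sq_nonneg β]
  have hα : 0 < α := by
    rcases pos_and_pos_or_neg_and_neg_of_mul_pos hprod with h | h <;> linarith [h.1, h.2]
  have hsq : 0 < α * (α * x ^ 2 + 2 * β * (x * y) + γ * y ^ 2) := by
    have heq : α * (α * x ^ 2 + 2 * β * (x * y) + γ * y ^ 2) =
        (α * x + β * y) ^ 2 + (α * γ - β ^ 2) * y ^ 2 := by ring
    rw [heq]
    by_cases hy : y = 0
    · have hx : x ≠ 0 := hxy.resolve_right (not_not.mpr hy)
      subst hy
      have := mul_ne_zero hα.ne' hx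
      simp only [mul_zero, add_zero, ne_eq, OfNat.ofNat_ne_zero, not_false_eq_true, zero_pow]
      positivity
    · positivity
  exact pos_of_mul_pos_right hsq hα.le

/-- The absolute value of a matrix diagonalized with eigenvalues `u ± s`, `0 ≤ u ≤ s`, is an affine
function of the matrix. -/
theorem abs_conj_diagonal {u s : ℝ} (hu : 0 ≤ u) (hus : u ≤ s) (hs : 0 < s)
    {R B : Matrix (Fin 2) (Fin 2) ℝ} (hR : IsUnit R.det)
    (hB : B = R * diagonal ![u + s, u - s] * R⁻¹) :
    R * diagonal ![|u + s|, |u - s|] * R⁻¹ = s • 1 + (u / s) • (B - u • 1) := by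
  have hdiag : diagonal ![|u + s|, |u - s|] =
      s • (1 : Matrix (Fin 2) (Fin 2) ℝ) + (u / s) • (diagonal ![u + s, u - s] - u • 1) := by
    rw [abs_of_nonneg (by linarith), abs_of_nonpos (by linarith)]
    ext i j
    fin_cases i <;> fin_cases j <;> simp <;> field_simp <;> ring
  rw [hdiag, hB]
  simp only [mul_add, add_mul, mul_sub, sub_mul, Matrix.mul_smul, Matrix.smul_mul, mul_one,
    Matrix.mul_nonsing_inv R hR]

/-- With `A_z = [[u, a/M],[a/M, u]]`, `P_z = [[1,p],[-p,1]]`,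
`a_p = sqrt (u² + (1+p²)(a²/M² - u²))` and `|P_z A_z| = R |Λ| R⁻¹` from a
diagonalization `P_z A_z = R diag (u + a_p, u - a_p) R⁻¹`, the matrix
`|P_z A_z| P_zᵀ` is positive definite: its symmetric part has trace
`2 a² det(P_z) / (M² a_p) > 0` and determinant
`a² (a² - M² u²) det(P_z)² / (M⁴ a_p²) > 0`. -/
theorem stmt_10 (u a M p : ℝ) (ha : 0 < a) (hM : 0 < M)
    (hu : 0 < M * u) (hsub : M * u < a)
    (R : Matrix (Fin 2) (Fin 2) ℝ) (hR : IsUnit R.det)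
    (hdiag :
      !![(1 : ℝ), p; -p, 1] * !![u, a / M; a / M, u] =
        R * Matrix.diagonal
          ![u + Real.sqrt (u ^ 2 + (1 + p ^ 2) * (a ^ 2 / M ^ 2 - u ^ 2)),
            u - Real.sqrt (u ^ 2 + (1 + p ^ 2) * (a ^ 2 / M ^ 2 - u ^ 2))] * R⁻¹) :
    (Matrix.trace ((1 / 2 : ℝ) •
        ((R * Matrix.diagonal
            ![|u + Real.sqrt (u ^ 2 + (1 + p ^ 2) * (a ^ 2 / M ^ 2 - u ^ 2))|,
              |u - Real.sqrt (u ^ 2 + (1 + p ^ 2) * (a ^ 2 / M ^ 2 - u ^ 2))|] * R⁻¹ *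
            (!![(1 : ℝ), p; -p, 1]).transpose) +
          (R * Matrix.diagonal
            ![|u + Real.sqrt (u ^ 2 + (1 + p ^ 2) * (a ^ 2 / M ^ 2 - u ^ 2))|,
              |u - Real.sqrt (u ^ 2 + (1 + p ^ 2) * (a ^ 2 / M ^ 2 - u ^ 2))|] * R⁻¹ *
            (!![(1 : ℝ), p; -p, 1]).transpose).transpose)) =
      2 * a ^ 2 * (!![(1 : ℝ), p; -p, 1]).det /
        (M ^ 2 * Real.sqrt (u ^ 2 + (1 + p ^ 2) * (a ^ 2 / M ^ 2 - u ^ 2)))) ∧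
    (((1 / 2 : ℝ) •
        ((R * Matrix.diagonal
            ![|u + Real.sqrt (u ^ 2 + (1 + p ^ 2) * (a ^ 2 / M ^ 2 - u ^ 2))|,
              |u - Real.sqrt (u ^ 2 + (1 + p ^ 2) * (a ^ 2 / M ^ 2 - u ^ 2))|] * R⁻¹ *
            (!![(1 : ℝ), p; -p, 1]).transpose) +
          (R * Matrix.diagonal
            ![|u + Real.sqrt (u ^ 2 + (1 + p ^ 2) * (a ^ 2 / M ^ 2 - u ^ 2))|,
              |u - Real.sqrt (u ^ 2 + (1 + p ^ 2) * (a ^ 2 / M ^ 2 - u ^ 2))|] * R⁻¹ *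
            (!![(1 : ℝ), p; -p, 1]).transpose).transpose)).det =
      a ^ 2 * (a ^ 2 - M ^ 2 * u ^ 2) * (!![(1 : ℝ), p; -p, 1]).det ^ 2 /
        (M ^ 4 * (u ^ 2 + (1 + p ^ 2) * (a ^ 2 / M ^ 2 - u ^ 2)))) ∧
    (∀ x : Fin 2 → ℝ, x ≠ 0 →
      0 < x ⬝ᵥ ((R * Matrix.diagonal
            ![|u + Real.sqrt (u ^ 2 + (1 + p ^ 2) * (a ^ 2 / M ^ 2 - u ^ 2))|,
              |u - Real.sqrt (u ^ 2 + (1 + p ^ 2) * (a ^ 2 / M ^ 2 - u ^ 2))|] * R⁻¹ *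
            (!![(1 : ℝ), p; -p, 1]).transpose) *ᵥ x)) := by
  set D := u ^ 2 + (1 + p ^ 2) * (a ^ 2 / M ^ 2 - u ^ 2) with hD
  set s := Real.sqrt D with hs_def
  set c := a / M with hc
  have hu0 : 0 < u := pos_of_mul_pos_right hu hM.le
  have huc : u < c := by rw [hc, lt_div_iff₀ hM]; linarith
  have hc0 : 0 < c := hu0.trans huc
  have hcu : 0 < c ^ 2 - u ^ 2 := by nlinarith
  have ha_eq : a = c * M := by rw [hc]; field_simp
  have hDc : D = (1 + p ^ 2) * c ^ 2 - p ^ 2 * u ^ 2 := by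
    rw [hD, ← div_pow, ← hc]; ring
  have huD : u ^ 2 < D := by
    rw [hDc]; nlinarith [mul_nonneg (sq_nonneg p) hcu.le]
  have hus : u < s := Real.lt_sqrt_of_sq_lt huD
  have hs : 0 < s := hu0.trans hus
  have hs2 : s ^ 2 = D := Real.sq_sqrt (by nlinarith)
  have hN : R * diagonal ![|u + s|, |u - s|] * R⁻¹ * (!![(1 : ℝ), p; -p, 1]).transpose =
      !![s + u / s * (2 * p * c + p ^ 2 * u),
          -(p * s) + u / s * (c + p * u - p ^ 2 * c);
        p * s + u / s * (c - p * u - p ^ 2 * c),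
          s + u / s * (p ^ 2 * u - 2 * p * c)] := by
    rw [abs_conj_diagonal hu0.le hus.le hs hR hdiag]
    ext i j
    fin_cases i <;> fin_cases j <;> simp [Matrix.mul_apply, Fin.sum_univ_two] <;> ring
  have htr : (s + u / s * (2 * p * c + p ^ 2 * u)) + (s + u / s * (p ^ 2 * u - 2 * p * c)) =
      2 * c ^ 2 * (1 + p ^ 2) / s := by
    field_simp
    linear_combination 2 * hs2 + 2 * hDc
  have hdet : (s + u / s * (2 * p * c + p ^ 2 * u)) * (s + u / s * (p ^ 2 * u - 2 * p * c)) -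
      (u / s * ((1 - p ^ 2) * c)) ^ 2 = c ^ 2 * (c ^ 2 - u ^ 2) * (1 + p ^ 2) ^ 2 / s ^ 2 := by
    have hs2' := hs2.trans hDc
    field_simp
    linear_combination (s ^ 2 + (1 + p ^ 2) * c ^ 2 + p ^ 2 * u ^ 2) * hs2'
  have hPdet : (!![(1 : ℝ), p; -p, 1]).det = 1 + p ^ 2 := by
    rw [Matrix.det_fin_two_of]; ring
  rw [hN, hPdet]
  refine ⟨?_, ?_, fun x hx => ?_⟩
  · have hrhs : 2 * a ^ 2 * (1 + p ^ 2) / (M ^ 2 * s) = 2 * c ^ 2 * (1 + p ^ 2) / s := by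
      rw [ha_eq]; field_simp
    rw [hrhs, ← htr]
    simp [Matrix.trace_fin_two]
    ring
  · have hrhs : a ^ 2 * (a ^ 2 - M ^ 2 * u ^ 2) * (1 + p ^ 2) ^ 2 / (M ^ 4 * D) =
        c ^ 2 * (c ^ 2 - u ^ 2) * (1 + p ^ 2) ^ 2 / s ^ 2 := by
      rw [ha_eq, ← hs2]; field_simp
    rw [hrhs, ← hdet]
    simp [Matrix.det_fin_two]
    ring
  · have hx' : x 0 ≠ 0 ∨ x 1 ≠ 0 := by
      by_contra! h
      exact hx (funext (Fin.forall_fin_two.mpr h))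
    have htr_pos : 0 < 2 * c ^ 2 * (1 + p ^ 2) / s := by positivity
    have hdet_pos : 0 < c ^ 2 * (c ^ 2 - u ^ 2) * (1 + p ^ 2) ^ 2 / s ^ 2 := by positivity
    have hpos := binary_form_pos (htr.symm ▸ htr_pos) (hdet.symm ▸ hdet_pos) hx'
    refine hpos.trans_eq ?_
    simp [Matrix.mulVec, dotProduct, Fin.sum_univ_two]
    ring
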